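/- arXiv:0905.4418 — 2 statements merged into one kernel-verified Lean document; each statement's English description precedes it below -/
import Mathlib

section
/- Let E1 be a two-dimensional vector space over ℂ and let E2 ⊂ E1 ⊗ E1, E3 ⊂ E1 ⊗ E1 ⊗ E1 be two-dimensional subspaces with E3 ⊂ (E2 ⊗ E1) ∩ (E1 ⊗ E2). Then there exist a two-dimensional (not necessarily unital) associative ℂ-algebra D whose multiplication map D ⊗ D → D is surjective, and an algebra automorphism η of D, such that the triple (E1, E2, E3) is isomorphic to the triple (F1, F2, F3), where F1 is the dual space of D; F2 ⊂ F1 ⊗ F1 is the space of all linear functionals on D ⊗ D of the form x ⊗ y ↦ f(x·η(y)) with f ∈ F1; and F3 ⊂ F1 ⊗ F1 ⊗ F1 is the space of all linear functionals on D ⊗ D ⊗ D of the form x ⊗ y ⊗ z ↦ f(x·η(y)·η²(z)) with f ∈ F1. -/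
open TensorProduct

/-- The subspace `L12 ⊗ L3` of `(L1 ⊗ L2) ⊗ L3`. -/
noncomputable def leftTensorSub {L1 L2 L3 : Type*} [AddCommGroup L1] [Module ℂ L1]
    [AddCommGroup L2] [Module ℂ L2] [AddCommGroup L3] [Module ℂ L3]
    (L12 : Submodule ℂ (L1 ⊗[ℂ] L2)) : Submodule ℂ ((L1 ⊗[ℂ] L2) ⊗[ℂ] L3) :=
  LinearMap.range (TensorProduct.mapIncl L12 (⊤ : Submodule ℂ L3))

/-- The subspace `L1 ⊗ L23` of `(L1 ⊗ L2) ⊗ L3`, transported along the associator. -/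
noncomputable def rightTensorSub {L1 L2 L3 : Type*} [AddCommGroup L1] [Module ℂ L1]
    [AddCommGroup L2] [Module ℂ L2] [AddCommGroup L3] [Module ℂ L3]
    (L23 : Submodule ℂ (L2 ⊗[ℂ] L3)) : Submodule ℂ ((L1 ⊗[ℂ] L2) ⊗[ℂ] L3) :=
  Submodule.map (TensorProduct.assoc ℂ L1 L2 L3).symm.toLinearMap
    (LinearMap.range (TensorProduct.mapIncl (⊤ : Submodule ℂ L1) L23))

namespace Stmt11

/-- The carrier of the two-dimensional algebra `D`. -/
abbrev V : Type := Fin 2 → ℂ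

/-- The linear map `D ⊗ D → D`, `x ⊗ y ↦ x · η(y)`. -/
noncomputable def T2 (m : V →ₗ[ℂ] V →ₗ[ℂ] V) (η : V ≃ₗ[ℂ] V) :
    (V ⊗[ℂ] V) →ₗ[ℂ] V :=
  (TensorProduct.lift m).comp (TensorProduct.map LinearMap.id η.toLinearMap)

/-- The linear map `D ⊗ D ⊗ D → D`, `x ⊗ y ⊗ z ↦ x · η(y) · η²(z)`. -/
noncomputable def T3 (m : V →ₗ[ℂ] V →ₗ[ℂ] V) (η : V ≃ₗ[ℂ] V) :
    ((V ⊗[ℂ] V) ⊗[ℂ] V) →ₗ[ℂ] V :=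
  (TensorProduct.lift m).comp (TensorProduct.map (T2 m η) (η.toLinearMap ^ 2))

/-- `F2`: the functionals `x ⊗ y ↦ f(x · η(y))`, as a subspace of `F1 ⊗ F1`. -/
noncomputable def F2 (m : V →ₗ[ℂ] V →ₗ[ℂ] V) (η : V ≃ₗ[ℂ] V) :
    Submodule ℂ (Module.Dual ℂ V ⊗[ℂ] Module.Dual ℂ V) :=
  LinearMap.range ((TensorProduct.dualDistribEquiv ℂ V V).symm.toLinearMap.comp
    (LinearMap.lcomp ℂ ℂ (T2 m η)))

/-- The canonical identification `(F1 ⊗ F1) ⊗ F1 ≃ Dual((D ⊗ D) ⊗ D)`. -/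
noncomputable def dual3Equiv :
    (Module.Dual ℂ V ⊗[ℂ] Module.Dual ℂ V) ⊗[ℂ] Module.Dual ℂ V ≃ₗ[ℂ]
      Module.Dual ℂ ((V ⊗[ℂ] V) ⊗[ℂ] V) :=
  (TensorProduct.congr (TensorProduct.dualDistribEquiv ℂ V V)
    (LinearEquiv.refl ℂ (Module.Dual ℂ V))).trans
    (TensorProduct.dualDistribEquiv ℂ (V ⊗[ℂ] V) V)

/-- `F3`: the functionals `x ⊗ y ⊗ z ↦ f(x · η(y) · η²(z))`, as a subspace of
`(F1 ⊗ F1) ⊗ F1`. -/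
noncomputable def F3 (m : V →ₗ[ℂ] V →ₗ[ℂ] V) (η : V ≃ₗ[ℂ] V) :
    Submodule ℂ ((Module.Dual ℂ V ⊗[ℂ] Module.Dual ℂ V) ⊗[ℂ] Module.Dual ℂ V) :=
  LinearMap.range (dual3Equiv.symm.toLinearMap.comp (LinearMap.lcomp ℂ ℂ (T3 m η)))


section helpers
variable {E : Type*} [AddCommGroup E] [Module ℂ E]

/-- contraction of the first factor -/
noncomputable def c2 (f : E →ₗ[ℂ] ℂ) : (E ⊗[ℂ] E) →ₗ[ℂ] E :=
  (TensorProduct.lid ℂ E).toLinearMap.comp (LinearMap.rTensor E f)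

/-- contraction of the first of three factors -/
noncomputable def c3 (f : E →ₗ[ℂ] ℂ) : ((E ⊗[ℂ] E) ⊗[ℂ] E) →ₗ[ℂ] E ⊗[ℂ] E :=
  ((TensorProduct.lid ℂ (E ⊗[ℂ] E)).toLinearMap.comp (LinearMap.rTensor (E ⊗[ℂ] E) f)).comp
    (TensorProduct.assoc ℂ E E E).toLinearMap

@[simp] lemma c2_tmul (f : E →ₗ[ℂ] ℂ) (x y : E) : c2 f (x ⊗ₜ y) = f x • y := by simp [c2]

@[simp] lemma c3_tmul (f : E →ₗ[ℂ] ℂ) (x y z : E) :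
    c3 f ((x ⊗ₜ y) ⊗ₜ z) = f x • (y ⊗ₜ z) := by simp [c3]

lemma left_form {W : Submodule ℂ (E ⊗[ℂ] E)} {s t : E ⊗[ℂ] E} {x : (E ⊗[ℂ] E) ⊗[ℂ] E}
    (hW : W ≤ Submodule.span ℂ {s, t})
    (hx : x ∈ leftTensorSub (L3 := E) W) :
    ∃ u v : E, x = s ⊗ₜ u + t ⊗ₜ v := by
  obtain ⟨y, rfl⟩ := hx
  induction y with
  | zero => exact ⟨0, 0, by simp⟩
  | tmul p q =>
    obtain ⟨α, β, h⟩ := Submodule.mem_span_pair.1 (hW p.2)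
    refine ⟨α • (q : E), β • (q : E), ?_⟩
    simp only [TensorProduct.mapIncl, TensorProduct.map_tmul, Submodule.subtype_apply, ← h,
      TensorProduct.add_tmul, TensorProduct.smul_tmul]
  | add y z hy hz =>
    obtain ⟨u, v, h⟩ := hy
    obtain ⟨u', v', h'⟩ := hz
    refine ⟨u + u', v + v', ?_⟩
    rw [map_add, h, h', TensorProduct.tmul_add, TensorProduct.tmul_add]
    abel

lemma right_contract {W : Submodule ℂ (E ⊗[ℂ] E)} {x : (E ⊗[ℂ] E) ⊗[ℂ] E}
    (hx : x ∈ rightTensorSub (L1 := E) W) (f : E →ₗ[ℂ] ℂ) : c3 f x ∈ W := by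
  obtain ⟨_, ⟨y, rfl⟩, rfl⟩ := hx
  induction y with
  | zero => simp
  | tmul p q =>
    simp only [c3, LinearMap.comp_apply, LinearEquiv.coe_coe, LinearEquiv.apply_symm_apply,
      TensorProduct.mapIncl, TensorProduct.map_tmul, Submodule.subtype_apply,
      LinearMap.rTensor_tmul, TensorProduct.lid_tmul]
    exact W.smul_mem _ q.2
  | add y z hy hz =>
    rw [map_add, map_add, map_add]
    exact W.add_mem hy hz

lemma exists_basis (h1 : Module.finrank ℂ E = 2) {a c : E}
    (h : LinearIndependent ℂ ![a, c]) :
    ∃ B : Module.Basis (Fin 2) ℂ E, B 0 = a ∧ B 1 = c := by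
  have : Module.Finite ℂ E := Module.finite_of_finrank_pos (by omega)
  refine ⟨basisOfLinearIndependentOfCardEqFinrank h (by simp [h1]), ?_, ?_⟩ <;> simp

lemma exists_compl (h1 : Module.finrank ℂ E = 2) {a : E} (ha : a ≠ 0) :
    ∃ B : Module.Basis (Fin 2) ℂ E, B 0 = a := by
  obtain ⟨c, hc⟩ := exists_linearIndependent_pair_of_one_lt_finrank (R := ℂ) (by omega) ha
  obtain ⟨B, h, -⟩ := exists_basis h1 hc
  exact ⟨B, h⟩

lemma expand (B : Module.Basis (Fin 2) ℂ E) (u : E) :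
    u = B.coord 0 u • B 0 + B.coord 1 u • B 1 := by
  have h := B.sum_repr u
  rw [Fin.sum_univ_two] at h
  exact h.symm

lemma expand2 (B C : Module.Basis (Fin 2) ℂ E) (t : E ⊗[ℂ] E) :
    ∃ α β γ δ : ℂ, t = α • (B 0 ⊗ₜ C 0) + β • (B 0 ⊗ₜ C 1) + γ • (B 1 ⊗ₜ C 0)
      + δ • (B 1 ⊗ₜ C 1) := by
  refine ⟨(B.tensorProduct C).repr t (0,0), (B.tensorProduct C).repr t (0,1),
    (B.tensorProduct C).repr t (1,0), (B.tensorProduct C).repr t (1,1), ?_⟩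
  have h := (B.tensorProduct C).sum_repr t
  rw [Fintype.sum_prod_type, Fin.sum_univ_two, Fin.sum_univ_two, Fin.sum_univ_two] at h
  simp only [Module.Basis.tensorProduct_apply] at h
  rw [add_assoc (_ + _)]
  exact h.symm

lemma exists_rank_one (h1 : Module.finrank ℂ E = 2)
    (E2 : Submodule ℂ (E ⊗[ℂ] E)) (h2 : Module.finrank ℂ E2 = 2) :
    ∃ a b : E, ∃ t, a ≠ 0 ∧ b ≠ 0 ∧ LinearIndependent ℂ ![a ⊗ₜ[ℂ] b, t] ∧
      E2 = Submodule.span ℂ {a ⊗ₜ[ℂ] b, t} := by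
  have : Module.Finite ℂ E := Module.finite_of_finrank_pos (by omega)
  let B : Module.Basis (Fin 2) ℂ E := Module.finBasisOfFinrankEq ℂ E h1
  let S : Module.Basis (Fin 2) ℂ E2 := Module.finBasisOfFinrankEq ℂ E2 h2
  -- a nonzero element with zero determinant
  have key : ∃ w ∈ E2, w ≠ 0 ∧ ∃ α β γ δ : ℂ, α * δ = β * γ ∧
      w = α • (B 0 ⊗ₜ B 0) + β • (B 0 ⊗ₜ B 1) + γ • (B 1 ⊗ₜ B 0) + δ • (B 1 ⊗ₜ B 1) := by
    obtain ⟨α, β, γ, δ, hs⟩ := expand2 B B (S 0 : E ⊗[ℂ] E)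
    obtain ⟨α', β', γ', δ', ht⟩ := expand2 B B (S 1 : E ⊗[ℂ] E)
    by_cases hd : α' * δ' - β' * γ' = 0
    · refine ⟨_, (S 1).2, ?_, α', β', γ', δ', by linear_combination hd, ht⟩
      have := S.ne_zero 1
      simpa using this
    · obtain ⟨r, hr⟩ := IsAlgClosed.exists_eq_mul_self
        (discrim (α' * δ' - β' * γ') (α * δ' + α' * δ - β * γ' - β' * γ) (α * δ - β * γ))
      obtain ⟨μ, hμ⟩ := exists_quadratic_eq_zero hd ⟨r, hr⟩
      refine ⟨_, (S 0 + μ • S 1).2, ?_, α + μ * α', β + μ * β', γ + μ * γ', δ + μ * δ',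
        by linear_combination hμ, ?_⟩
      · intro h
        have h' : S 0 + μ • S 1 = 0 := Subtype.ext h
        have := congrArg (fun z => S.repr z 0) h'
        simp at this
      · rw [Submodule.coe_add, Submodule.coe_smul, hs, ht]
        module
  obtain ⟨w, hw, hw0, α, β, γ, δ, hdet, hexp⟩ := key
  obtain ⟨a, b, hab⟩ : ∃ a b : E, w = a ⊗ₜ[ℂ] b := by
    by_cases hα : α = 0
    · by_cases hβ : β = 0
      · refine ⟨B 1, γ • B 0 + δ • B 1, ?_⟩
        rw [hexp, hα, hβ]; simp [TensorProduct.tmul_add]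
      · have hγ : γ = 0 := by
          have : β * γ = 0 := by rw [← hdet, hα, zero_mul]
          simpa [hβ] using this
        refine ⟨β • B 0 + δ • B 1, B 1, ?_⟩
        rw [hexp, hα, hγ]; simp [TensorProduct.add_tmul, TensorProduct.smul_tmul']
    · refine ⟨B 0 + (γ / α) • B 1, α • B 0 + β • B 1, ?_⟩
      have hδ : δ = γ / α * β := by field_simp; linear_combination hdet
      have hγ : γ = γ / α * α := by field_simp
      rw [hexp, hδ]
      conv_lhs => rw [hγ]
      simp only [TensorProduct.add_tmul, TensorProduct.tmul_add, TensorProduct.tmul_smul,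
        ← TensorProduct.smul_tmul']
      match_scalars <;> field_simp
  have ha : a ≠ 0 := by rintro rfl; simp at hab; exact hw0 hab
  have hb : b ≠ 0 := by rintro rfl; simp at hab; exact hw0 hab
  have hw1 : (⟨w, hw⟩ : E2) ≠ 0 := by simpa using hw0
  obtain ⟨t, ht⟩ := exists_linearIndependent_pair_of_one_lt_finrank (R := ℂ)
    (M := E2) (by omega) hw1
  have hli : LinearIndependent ℂ ![w, (t : E ⊗[ℂ] E)] := by
    have := ht.map' E2.subtype (Submodule.ker_subtype _)
    have e : ![w, (t : E ⊗[ℂ] E)] = E2.subtype ∘ ![⟨w, hw⟩, t] := by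
      ext i; fin_cases i <;> rfl
    rw [e]; exact this
  refine ⟨a, b, t, ha, hb, hab ▸ hli, ?_⟩
  rw [← hab]
  symm
  apply Submodule.eq_of_le_of_finrank_eq
  · rw [Submodule.span_le]
    rintro x (rfl | rfl)
    · exact hw
    · exact t.2
  · rw [h2]
    have := finrank_span_eq_card hli
    rw [Matrix.range_cons, Matrix.range_cons, Matrix.range_empty, Set.union_empty,
      Set.singleton_union] at this
    simpa using this

lemma span_pair_scale {M : Type*} [AddCommGroup M] [Module ℂ M] {s t s' t' : M}
    (α β γ : ℂ) (hα : α ≠ 0) (hγ : γ ≠ 0) (hs : s' = α • s) (ht : t' = β • s + γ • t) :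
    Submodule.span ℂ {s, t} = Submodule.span ℂ {s', t'} := by
  subst hs ht
  apply le_antisymm
  · rw [Submodule.span_le]
    rintro x (rfl | rfl)
    · exact Submodule.mem_span_pair.2 ⟨α⁻¹, 0, by simp [smul_smul, hα]⟩
    · refine Submodule.mem_span_pair.2 ⟨-(γ⁻¹ * β * α⁻¹), γ⁻¹, ?_⟩
      match_scalars <;> field_simp <;> ring
  · rw [Submodule.span_le]
    rintro x (rfl | rfl)
    · exact Submodule.mem_span_pair.2 ⟨α, 0, by simp⟩
    · exact Submodule.mem_span_pair.2 ⟨β, γ, rfl⟩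

/-- Pencils of 2x2 matrices -/
lemma classify (h1 : Module.finrank ℂ E = 2)
    (E2 : Submodule ℂ (E ⊗[ℂ] E)) (h2 : Module.finrank ℂ E2 = 2) :
    ∃ B C : Module.Basis (Fin 2) ℂ E,
      E2 = Submodule.span ℂ {B 0 ⊗ₜ[ℂ] C 0, B 0 ⊗ₜ[ℂ] C 1} ∨
      E2 = Submodule.span ℂ {B 0 ⊗ₜ[ℂ] C 0, B 1 ⊗ₜ[ℂ] C 0} ∨
      E2 = Submodule.span ℂ {B 0 ⊗ₜ[ℂ] C 0, B 1 ⊗ₜ[ℂ] C 1} ∨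
      E2 = Submodule.span ℂ {B 0 ⊗ₜ[ℂ] C 0, B 0 ⊗ₜ[ℂ] C 1 + B 1 ⊗ₜ[ℂ] C 0} := by
  obtain ⟨a, b, t, ha, hb, hli, rfl⟩ := exists_rank_one h1 E2 h2
  obtain ⟨B, rfl⟩ := exists_compl h1 ha
  obtain ⟨C, rfl⟩ := exists_compl h1 hb
  obtain ⟨α, β, γ, δ, rfl⟩ := expand2 B C t
  -- changing the second basis vector
  have chg : ∀ (D : Module.Basis (Fin 2) ℂ E) (p q : ℂ), q ≠ 0 →
      ∃ D' : Module.Basis (Fin 2) ℂ E, D' 0 = D 0 ∧ D' 1 = p • D 0 + q • D 1 := by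
    intro D p q hq
    apply exists_basis h1
    rw [LinearIndependent.pair_iff]
    intro x y h
    have e0 := congrArg (fun z => D.repr z 0) h
    have e1 := congrArg (fun z => D.repr z 1) h
    simp [hq] at e0 e1
    simpa [e1] using e0
  by_cases hδ : δ = 0
  · subst hδ
    by_cases hβ : β = 0
    · by_cases hγ : γ = 0
      · exfalso
        subst hβ hγ
        rw [LinearIndependent.pair_iff] at hli
        have := (hli (-α) 1 (by module)).2
        simp at this
      · refine ⟨B, C, Or.inr (Or.inl ?_)⟩
        subst hβ
        exact (span_pair_scale 1 α γ one_ne_zero hγ (by module) (by module)).symm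
    · by_cases hγ : γ = 0
      · refine ⟨B, C, Or.inl ?_⟩
        subst hγ
        exact (span_pair_scale 1 α β one_ne_zero hβ (by module) (by module)).symm
      · obtain ⟨B', hB0, hB1⟩ := chg B 0 γ hγ
        obtain ⟨C', hC0, hC1⟩ := chg C 0 β hβ
        refine ⟨B', C', Or.inr (Or.inr (Or.inr ?_))⟩
        rw [hB0, hB1, hC0, hC1]
        refine span_pair_scale 1 (-α) 1 one_ne_zero one_ne_zero (by module) ?_
        simp only [TensorProduct.add_tmul, TensorProduct.tmul_add, TensorProduct.tmul_smul,
          ← TensorProduct.smul_tmul']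
        module
  · obtain ⟨B', hB0, hB1⟩ := chg B β δ hδ
    obtain ⟨C', hC0, hC1⟩ := chg C (γ / δ) 1 one_ne_zero
    refine ⟨B', C', Or.inr (Or.inr (Or.inl ?_))⟩
    rw [hB0, hB1, hC0, hC1]
    refine span_pair_scale 1 (β * γ / δ - α) 1 one_ne_zero one_ne_zero (by module) ?_
    simp only [TensorProduct.add_tmul, TensorProduct.tmul_add, TensorProduct.tmul_smul,
      ← TensorProduct.smul_tmul']
    match_scalars <;> field_simp <;> ring

end helpers

section finishing
variable {E : Type*} [AddCommGroup E] [Module ℂ E]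

/-- the basis-induced identification with the dual of `V` -/
noncomputable def th (B : Module.Basis (Fin 2) ℂ E) : E ≃ₗ[ℂ] Module.Dual ℂ V :=
  B.equiv (Pi.basisFun ℂ (Fin 2)).dualBasis (Equiv.refl _)

@[simp] lemma th_apply (B : Module.Basis (Fin 2) ℂ E) (i : Fin 2) (v : V) :
    th B (B i) v = v i := by
  simp [th, Module.Basis.equiv_apply]

lemma eq_aux {M : Type*} [AddCommMonoid M] [Module ℂ M] [Module.Finite ℂ M]
    {S T : Submodule ℂ M} (h : S ≤ T) (h' : Module.finrank ℂ T ≤ Module.finrank ℂ S) : S = T := by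
  letI : AddCommGroup M := Module.addCommMonoidToAddCommGroup ℂ
  exact Submodule.eq_of_le_of_finrank_le h h'

lemma finish (B : Module.Basis (Fin 2) ℂ E)
    (E2 : Submodule ℂ (E ⊗[ℂ] E)) (E3 : Submodule ℂ ((E ⊗[ℂ] E) ⊗[ℂ] E))
    (h2 : Module.finrank ℂ E2 = 2) (h3 : Module.finrank ℂ E3 = 2)
    (m : V →ₗ[ℂ] V →ₗ[ℂ] V)
    (hm : ∀ x y z : V, m (m x y) z = m x (m y z))
    (hsurj : ∀ x : V, ∃ y z, m y z = x)
    (η : V ≃ₗ[ℂ] V) (hη : ∀ x y : V, η (m x y) = m (η x) (η y))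
    (s : Fin 2 → E ⊗[ℂ] E) (p : Fin 2 → (E ⊗[ℂ] E) ⊗[ℂ] E)
    (hE2 : E2 ≤ Submodule.span ℂ {s 0, s 1})
    (hE3 : E3 ≤ Submodule.span ℂ {p 0, p 1})
    (hs : ∀ i x y, TensorProduct.dualDistrib ℂ V V
      (TensorProduct.map (th B).toLinearMap (th B).toLinearMap (s i)) (x ⊗ₜ y) = m x (η y) i)
    (hp : ∀ i x y z, TensorProduct.dualDistrib ℂ (V ⊗[ℂ] V) V
      (TensorProduct.map (TensorProduct.dualDistrib ℂ V V) LinearMap.id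
      (TensorProduct.map (TensorProduct.map (th B).toLinearMap (th B).toLinearMap)
        (th B).toLinearMap (p i))) ((x ⊗ₜ y) ⊗ₜ z) = m (m x (η y)) (η (η z)) i) :
    ∃ m : V →ₗ[ℂ] V →ₗ[ℂ] V,
      (∀ x y z : V, m (m x y) z = m x (m y z)) ∧
      Function.Surjective (TensorProduct.lift m) ∧
      ∃ η : V ≃ₗ[ℂ] V,
        (∀ x y : V, η (m x y) = m (η x) (η y)) ∧
        ∃ θ : E ≃ₗ[ℂ] Module.Dual ℂ V,
          Submodule.map (TensorProduct.map θ.toLinearMap θ.toLinearMap) E2 = F2 m η ∧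
          Submodule.map (TensorProduct.map
            (TensorProduct.map θ.toLinearMap θ.toLinearMap) θ.toLinearMap) E3 = F3 m η := by
  have : Module.Finite ℂ E := Module.Finite.of_basis B
  refine ⟨m, hm, ?_, η, hη, th B, ?_, ?_⟩
  · intro x
    obtain ⟨y, z, h⟩ := hsurj x
    exact ⟨y ⊗ₜ z, by simpa using h⟩
  · have hmem : ∀ i, TensorProduct.map (th B).toLinearMap (th B).toLinearMap (s i) ∈ F2 m η := by
      intro i
      refine ⟨LinearMap.proj i, ?_⟩
      rw [LinearMap.comp_apply, LinearEquiv.coe_coe, LinearEquiv.symm_apply_eq]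
      refine TensorProduct.ext' fun x y => ?_
      refine Eq.trans ?_ (hs i x y).symm
      simp [T2]
    apply eq_aux
    · rw [Submodule.map_le_iff_le_comap]
      refine hE2.trans ?_
      rw [Submodule.span_le]
      rintro x (rfl | rfl)
      · exact hmem 0
      · exact hmem 1
    · have e := LinearEquiv.finrank_map_eq (TensorProduct.congr (th B) (th B)) E2
      have e' : Module.finrank ℂ (Submodule.map
        (TensorProduct.map (th B).toLinearMap (th B).toLinearMap) E2) = 2 := by
        exact e.trans h2
      rw [e']
      refine (LinearMap.finrank_range_le _).trans ?_
      simp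
  · have hmem : ∀ i, TensorProduct.map (TensorProduct.map (th B).toLinearMap (th B).toLinearMap)
        (th B).toLinearMap (p i) ∈ F3 m η := by
      intro i
      refine ⟨LinearMap.proj i, ?_⟩
      rw [LinearMap.comp_apply, LinearEquiv.coe_coe, LinearEquiv.symm_apply_eq]
      refine TensorProduct.ext_threefold fun x y z => ?_
      refine Eq.trans ?_ (hp i x y z).symm
      simp [T3, T2, pow_two]
    apply eq_aux
    · rw [Submodule.map_le_iff_le_comap]
      refine hE3.trans ?_
      rw [Submodule.span_le]
      rintro x (rfl | rfl)
      · exact hmem 0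
      · exact hmem 1
    · have e := LinearEquiv.finrank_map_eq
        (TensorProduct.congr (TensorProduct.congr (th B) (th B)) (th B)) E3
      have e' : Module.finrank ℂ (Submodule.map (TensorProduct.map
        (TensorProduct.map (th B).toLinearMap (th B).toLinearMap) (th B).toLinearMap) E3) = 2 := by
        exact e.trans h3
      rw [e']
      refine (LinearMap.finrank_range_le _).trans ?_
      simp

/-- the scaling automorphism -/
noncomputable def etaScale (α : ℂ) (hα : α ≠ 0) : V ≃ₗ[ℂ] V :=
  LinearEquiv.ofLinearMap
    { toFun := fun x => ![x 0, α * x 1]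
      map_add' := by intro x y; ext i; fin_cases i <;> simp [mul_add]
      map_smul' := by intro c x; ext i; fin_cases i <;> simp [mul_left_comm] }
    { toFun := fun x => ![x 0, α⁻¹ * x 1]
      map_add' := by intro x y; ext i; fin_cases i <;> simp [mul_add]
      map_smul' := by intro c x; ext i; fin_cases i <;> simp [mul_left_comm] }
    (by ext x i; fin_cases i <;> simp [hα]) (by ext x i; fin_cases i <;> simp [hα])

@[simp] lemma etaScale_apply (α : ℂ) (hα : α ≠ 0) (x : V) :
    etaScale α hα x = ![x 0, α * x 1] := rfl

noncomputable def m1 : V →ₗ[ℂ] V →ₗ[ℂ] V :=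
  LinearMap.mk₂ ℂ (fun x y => ![x 0 * y 0, x 0 * y 1])
    (by intro x y z; ext i; fin_cases i <;> simp <;> ring)
    (by intro x y z; ext i; fin_cases i <;> simp <;> ring)
    (by intro x y z; ext i; fin_cases i <;> simp <;> ring)
    (by intro x y z; ext i; fin_cases i <;> simp <;> ring)

noncomputable def m2 : V →ₗ[ℂ] V →ₗ[ℂ] V :=
  LinearMap.mk₂ ℂ (fun x y => ![x 0 * y 0, x 1 * y 0])
    (by intro x y z; ext i; fin_cases i <;> simp <;> ring)
    (by intro x y z; ext i; fin_cases i <;> simp <;> ring)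
    (by intro x y z; ext i; fin_cases i <;> simp <;> ring)
    (by intro x y z; ext i; fin_cases i <;> simp <;> ring)

noncomputable def m3 : V →ₗ[ℂ] V →ₗ[ℂ] V :=
  LinearMap.mk₂ ℂ (fun x y => ![x 0 * y 0, x 1 * y 1])
    (by intro x y z; ext i; fin_cases i <;> simp <;> ring)
    (by intro x y z; ext i; fin_cases i <;> simp <;> ring)
    (by intro x y z; ext i; fin_cases i <;> simp <;> ring)
    (by intro x y z; ext i; fin_cases i <;> simp <;> ring)

noncomputable def m4 : V →ₗ[ℂ] V →ₗ[ℂ] V :=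
  LinearMap.mk₂ ℂ (fun x y => ![x 0 * y 0, x 0 * y 1 + x 1 * y 0])
    (by intro x y z; ext i; fin_cases i <;> simp <;> ring)
    (by intro x y z; ext i; fin_cases i <;> simp <;> ring)
    (by intro x y z; ext i; fin_cases i <;> simp <;> ring)
    (by intro x y z; ext i; fin_cases i <;> simp <;> ring)

@[simp] lemma m1_apply (x y : V) : m1 x y = ![x 0 * y 0, x 0 * y 1] := rfl
@[simp] lemma m2_apply (x y : V) : m2 x y = ![x 0 * y 0, x 1 * y 0] := rfl
@[simp] lemma m3_apply (x y : V) : m3 x y = ![x 0 * y 0, x 1 * y 1] := rfl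
@[simp] lemma m4_apply (x y : V) : m4 x y = ![x 0 * y 0, x 0 * y 1 + x 1 * y 0] := rfl

/-- the conclusion of the theorem -/
def Concl (E2 : Submodule ℂ (E ⊗[ℂ] E)) (E3 : Submodule ℂ ((E ⊗[ℂ] E) ⊗[ℂ] E)) : Prop :=
    ∃ m : V →ₗ[ℂ] V →ₗ[ℂ] V,
      (∀ x y z : V, m (m x y) z = m x (m y z)) ∧
      Function.Surjective (TensorProduct.lift m) ∧
      ∃ η : V ≃ₗ[ℂ] V,
        (∀ x y : V, η (m x y) = m (η x) (η y)) ∧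
        ∃ θ : E ≃ₗ[ℂ] Module.Dual ℂ V,
          Submodule.map (TensorProduct.map θ.toLinearMap θ.toLinearMap) E2 = F2 m η ∧
          Submodule.map (TensorProduct.map
            (TensorProduct.map θ.toLinearMap θ.toLinearMap) θ.toLinearMap) E3 = F3 m η

section cases
variable (B : Module.Basis (Fin 2) ℂ E)
    (E2 : Submodule ℂ (E ⊗[ℂ] E)) (E3 : Submodule ℂ ((E ⊗[ℂ] E) ⊗[ℂ] E))

lemma concl1 (h2 : Module.finrank ℂ E2 = 2) (h3 : Module.finrank ℂ E3 = 2)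
    (hE2 : E2 ≤ Submodule.span ℂ {B 0 ⊗ₜ[ℂ] B 0, B 0 ⊗ₜ[ℂ] B 1})
    (hE3 : E3 ≤ Submodule.span ℂ {(B 0 ⊗ₜ[ℂ] B 0) ⊗ₜ[ℂ] B 0, (B 0 ⊗ₜ[ℂ] B 0) ⊗ₜ[ℂ] B 1}) :
    Concl E2 E3 := by
  refine finish B E2 E3 h2 h3 m1 ?_ ?_ (LinearEquiv.refl ℂ V) ?_
    ![B 0 ⊗ₜ[ℂ] B 0, B 0 ⊗ₜ[ℂ] B 1]
    ![(B 0 ⊗ₜ[ℂ] B 0) ⊗ₜ[ℂ] B 0, (B 0 ⊗ₜ[ℂ] B 0) ⊗ₜ[ℂ] B 1] hE2 hE3 ?_ ?_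
  · intro x y z; ext i; fin_cases i <;> simp <;> ring
  · intro x; refine ⟨![1, 0], x, ?_⟩; ext i; fin_cases i <;> simp
  · intro x y; rfl
  · intro i x y; fin_cases i <;> simp
  · intro i x y z; fin_cases i <;> simp

lemma concl2 (h2 : Module.finrank ℂ E2 = 2) (h3 : Module.finrank ℂ E3 = 2)
    (hE2 : E2 ≤ Submodule.span ℂ {B 0 ⊗ₜ[ℂ] B 0, B 1 ⊗ₜ[ℂ] B 0})
    (hE3 : E3 ≤ Submodule.span ℂ {(B 0 ⊗ₜ[ℂ] B 0) ⊗ₜ[ℂ] B 0, (B 1 ⊗ₜ[ℂ] B 0) ⊗ₜ[ℂ] B 0}) :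
    Concl E2 E3 := by
  refine finish B E2 E3 h2 h3 m2 ?_ ?_ (LinearEquiv.refl ℂ V) ?_
    ![B 0 ⊗ₜ[ℂ] B 0, B 1 ⊗ₜ[ℂ] B 0]
    ![(B 0 ⊗ₜ[ℂ] B 0) ⊗ₜ[ℂ] B 0, (B 1 ⊗ₜ[ℂ] B 0) ⊗ₜ[ℂ] B 0] hE2 hE3 ?_ ?_
  · intro x y z; ext i; fin_cases i <;> simp <;> ring
  · intro x; refine ⟨x, ![1, 0], ?_⟩; ext i; fin_cases i <;> simp
  · intro x y; rfl
  · intro i x y; fin_cases i <;> simp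
  · intro i x y z; fin_cases i <;> simp

lemma concl3 (h2 : Module.finrank ℂ E2 = 2) (h3 : Module.finrank ℂ E3 = 2)
    (hE2 : E2 ≤ Submodule.span ℂ {B 0 ⊗ₜ[ℂ] B 0, B 1 ⊗ₜ[ℂ] B 1})
    (hE3 : E3 ≤ Submodule.span ℂ {(B 0 ⊗ₜ[ℂ] B 0) ⊗ₜ[ℂ] B 0, (B 1 ⊗ₜ[ℂ] B 1) ⊗ₜ[ℂ] B 1}) :
    Concl E2 E3 := by
  refine finish B E2 E3 h2 h3 m3 ?_ ?_ (LinearEquiv.refl ℂ V) ?_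
    ![B 0 ⊗ₜ[ℂ] B 0, B 1 ⊗ₜ[ℂ] B 1]
    ![(B 0 ⊗ₜ[ℂ] B 0) ⊗ₜ[ℂ] B 0, (B 1 ⊗ₜ[ℂ] B 1) ⊗ₜ[ℂ] B 1] hE2 hE3 ?_ ?_
  · intro x y z; ext i; fin_cases i <;> simp <;> ring
  · intro x; refine ⟨x, ![1, 1], ?_⟩; ext i; fin_cases i <;> simp
  · intro x y; rfl
  · intro i x y; fin_cases i <;> simp
  · intro i x y z; fin_cases i <;> simp

lemma concl3' (h2 : Module.finrank ℂ E2 = 2) (h3 : Module.finrank ℂ E3 = 2)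
    (hE2 : E2 ≤ Submodule.span ℂ {B 0 ⊗ₜ[ℂ] B 1, B 1 ⊗ₜ[ℂ] B 0})
    (hE3 : E3 ≤ Submodule.span ℂ {(B 0 ⊗ₜ[ℂ] B 1) ⊗ₜ[ℂ] B 0, (B 1 ⊗ₜ[ℂ] B 0) ⊗ₜ[ℂ] B 1}) :
    Concl E2 E3 := by
  refine finish B E2 E3 h2 h3 m3 ?_ ?_ (LinearEquiv.funCongrLeft ℂ ℂ (Equiv.swap 0 1)) ?_
    ![B 0 ⊗ₜ[ℂ] B 1, B 1 ⊗ₜ[ℂ] B 0]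
    ![(B 0 ⊗ₜ[ℂ] B 1) ⊗ₜ[ℂ] B 0, (B 1 ⊗ₜ[ℂ] B 0) ⊗ₜ[ℂ] B 1] hE2 hE3 ?_ ?_
  · intro x y z; ext i; fin_cases i <;> simp <;> ring
  · intro x; refine ⟨x, ![1, 1], ?_⟩; ext i; fin_cases i <;> simp
  · intro x y; ext i; fin_cases i <;> simp [LinearMap.funLeft_apply]
  · intro i x y; fin_cases i <;> simp [LinearMap.funLeft_apply]
  · intro i x y z; fin_cases i <;> simp [LinearMap.funLeft_apply]

lemma concl4 (h2 : Module.finrank ℂ E2 = 2) (h3 : Module.finrank ℂ E3 = 2)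
    (α : ℂ) (hα : α ≠ 0)
    (hE2 : E2 ≤ Submodule.span ℂ {B 0 ⊗ₜ[ℂ] B 0, α • (B 0 ⊗ₜ[ℂ] B 1) + B 1 ⊗ₜ[ℂ] B 0})
    (hE3 : E3 ≤ Submodule.span ℂ {(B 0 ⊗ₜ[ℂ] B 0) ⊗ₜ[ℂ] B 0,
      (α * α) • ((B 0 ⊗ₜ[ℂ] B 0) ⊗ₜ[ℂ] B 1) + α • ((B 0 ⊗ₜ[ℂ] B 1) ⊗ₜ[ℂ] B 0)
        + (B 1 ⊗ₜ[ℂ] B 0) ⊗ₜ[ℂ] B 0}) :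
    Concl E2 E3 := by
  refine finish B E2 E3 h2 h3 m4 ?_ ?_ (etaScale α hα) ?_
    ![B 0 ⊗ₜ[ℂ] B 0, α • (B 0 ⊗ₜ[ℂ] B 1) + B 1 ⊗ₜ[ℂ] B 0]
    ![(B 0 ⊗ₜ[ℂ] B 0) ⊗ₜ[ℂ] B 0,
      (α * α) • ((B 0 ⊗ₜ[ℂ] B 0) ⊗ₜ[ℂ] B 1) + α • ((B 0 ⊗ₜ[ℂ] B 1) ⊗ₜ[ℂ] B 0)
        + (B 1 ⊗ₜ[ℂ] B 0) ⊗ₜ[ℂ] B 0] hE2 hE3 ?_ ?_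
  · intro x y z; ext i; fin_cases i <;> simp <;> ring
  · intro x; refine ⟨x, ![1, 0], ?_⟩; ext i; fin_cases i <;> simp
  · intro x y; ext i; fin_cases i <;> simp; ring
  · intro i x y; fin_cases i <;> simp; ring
  · intro i x y z; fin_cases i <;> simp; ring

end cases
end finishing

section shapes
variable {E : Type*} [AddCommGroup E] [Module ℂ E]
variable (B C : Module.Basis (Fin 2) ℂ E)
    (E2 : Submodule ℂ (E ⊗[ℂ] E)) (E3 : Submodule ℂ ((E ⊗[ℂ] E) ⊗[ℂ] E))

/-- elements of `E3` in terms of generators of `E2` -/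
lemma forms {E2 : Submodule ℂ (E ⊗[ℂ] E)} {E3 : Submodule ℂ ((E ⊗[ℂ] E) ⊗[ℂ] E)}
    (hsub : E3 ≤ leftTensorSub (L3 := E) E2 ⊓ rightTensorSub (L1 := E) E2)
    {s t : E ⊗[ℂ] E} (hE2 : E2 ≤ Submodule.span ℂ {s, t})
    {x : (E ⊗[ℂ] E) ⊗[ℂ] E} (hx : x ∈ E3) :
    ∃ u v : E, x = s ⊗ₜ u + t ⊗ₜ v ∧
      ∀ f : E →ₗ[ℂ] ℂ, ∃ p q : ℂ, p • s + q • t = c3 f (s ⊗ₜ u + t ⊗ₜ v) := by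
  obtain ⟨u, v, rfl⟩ := left_form hE2 (hsub hx).1
  exact ⟨u, v, rfl, fun f => Submodule.mem_span_pair.1 (hE2 (right_contract (hsub hx).2 f))⟩

lemma shape1 (h2 : Module.finrank ℂ E2 = 2) (h3 : Module.finrank ℂ E3 = 2)
    (hsub : E3 ≤ leftTensorSub (L3 := E) E2 ⊓ rightTensorSub (L1 := E) E2)
    (hE2 : E2 ≤ Submodule.span ℂ {B 0 ⊗ₜ[ℂ] B 0, B 0 ⊗ₜ[ℂ] B 1}) : Concl E2 E3 := by
  refine concl1 B E2 E3 h2 h3 hE2 fun x hx => ?_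
  obtain ⟨u, v, rfl, hc⟩ := forms hsub hE2 hx
  obtain ⟨p, q, h⟩ := hc (B.coord 0)
  have e := congrArg (c2 (B.coord 1)) h
  simp at e
  subst e
  refine Submodule.mem_span_pair.2 ⟨B.coord 0 u, B.coord 1 u, ?_⟩
  conv_rhs => rw [expand B u]
  simp only [TensorProduct.tmul_add, TensorProduct.tmul_smul, TensorProduct.tmul_zero, add_zero]

lemma shape2 (h2 : Module.finrank ℂ E2 = 2) (h3 : Module.finrank ℂ E3 = 2)
    (hsub : E3 ≤ leftTensorSub (L3 := E) E2 ⊓ rightTensorSub (L1 := E) E2)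
    (hE2 : E2 ≤ Submodule.span ℂ {B 0 ⊗ₜ[ℂ] B 0, B 1 ⊗ₜ[ℂ] B 0}) : Concl E2 E3 := by
  refine concl2 B E2 E3 h2 h3 hE2 fun x hx => ?_
  obtain ⟨u, v, rfl, hc⟩ := forms hsub hE2 hx
  obtain ⟨p, q, h⟩ := hc (B.coord 0)
  obtain ⟨p', q', h'⟩ := hc (B.coord 1)
  have e := congrArg (c2 (B.coord 0)) h
  have e' := congrArg (c2 (B.coord 0)) h'
  simp at e e'
  subst e e'
  exact Submodule.mem_span_pair.2 ⟨p, p', by simp only [TensorProduct.tmul_smul]⟩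

lemma shape3 (h2 : Module.finrank ℂ E2 = 2) (h3 : Module.finrank ℂ E3 = 2)
    (hsub : E3 ≤ leftTensorSub (L3 := E) E2 ⊓ rightTensorSub (L1 := E) E2)
    (hE2 : E2 ≤ Submodule.span ℂ {B 0 ⊗ₜ[ℂ] B 0, B 1 ⊗ₜ[ℂ] B 1}) : Concl E2 E3 := by
  refine concl3 B E2 E3 h2 h3 hE2 fun x hx => ?_
  obtain ⟨u, v, rfl, hc⟩ := forms hsub hE2 hx
  obtain ⟨p, q, h⟩ := hc (B.coord 0)
  obtain ⟨p', q', h'⟩ := hc (B.coord 1)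
  have e := congrArg (c2 (B.coord 0)) h
  have e' := congrArg (c2 (B.coord 1)) h'
  simp at e e'
  subst e e'
  exact Submodule.mem_span_pair.2 ⟨p, q', by simp only [TensorProduct.tmul_smul]⟩

lemma shape3' (h2 : Module.finrank ℂ E2 = 2) (h3 : Module.finrank ℂ E3 = 2)
    (hsub : E3 ≤ leftTensorSub (L3 := E) E2 ⊓ rightTensorSub (L1 := E) E2)
    (hE2 : E2 ≤ Submodule.span ℂ {B 0 ⊗ₜ[ℂ] B 1, B 1 ⊗ₜ[ℂ] B 0}) : Concl E2 E3 := by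
  refine concl3' B E2 E3 h2 h3 hE2 fun x hx => ?_
  obtain ⟨u, v, rfl, hc⟩ := forms hsub hE2 hx
  obtain ⟨p, q, h⟩ := hc (B.coord 0)
  obtain ⟨p', q', h'⟩ := hc (B.coord 1)
  have e := congrArg (c2 (B.coord 1)) h
  have e' := congrArg (c2 (B.coord 0)) h'
  simp at e e'
  subst e e'
  exact Submodule.mem_span_pair.2 ⟨q, p', by simp only [TensorProduct.tmul_smul]⟩

lemma shape4 (h2 : Module.finrank ℂ E2 = 2) (h3 : Module.finrank ℂ E3 = 2)
    (hsub : E3 ≤ leftTensorSub (L3 := E) E2 ⊓ rightTensorSub (L1 := E) E2)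
    (α : ℂ) (hα : α ≠ 0)
    (hE2 : E2 ≤ Submodule.span ℂ {B 0 ⊗ₜ[ℂ] B 0, α • (B 0 ⊗ₜ[ℂ] B 1) + B 1 ⊗ₜ[ℂ] B 0}) :
    Concl E2 E3 := by
  refine concl4 B E2 E3 h2 h3 α hα hE2 fun x hx => ?_
  obtain ⟨u, v, rfl, hc⟩ := forms hsub hE2 hx
  obtain ⟨p, q, h⟩ := hc (B.coord 0)
  have e := congrArg (c2 (B.coord 0)) h
  have e' := congrArg (c2 (B.coord 1)) h
  simp [TensorProduct.add_tmul, ← TensorProduct.smul_tmul'] at e e'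
  have e'' : v = (q / α) • B 0 := by
    rw [div_eq_inv_mul, mul_smul, e', smul_smul, inv_mul_cancel₀ hα, one_smul]
  subst e e''
  refine Submodule.mem_span_pair.2 ⟨p, q / α, ?_⟩
  simp only [TensorProduct.add_tmul, TensorProduct.tmul_add, TensorProduct.tmul_smul,
    ← TensorProduct.smul_tmul']
  match_scalars <;> field_simp

lemma not_line (h3 : Module.finrank ℂ E3 = 2) (w : (E ⊗[ℂ] E) ⊗[ℂ] E)
    (h : ∀ x ∈ E3, ∃ r : ℂ, x = r • w) : False := by
  have hle : E3 ≤ Submodule.span ℂ {w} := fun x hx => by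
    obtain ⟨r, rfl⟩ := h x hx
    exact Submodule.smul_mem _ _ (Submodule.mem_span_singleton_self w)
  have h4 := Submodule.finrank_mono hle
  have h5 : Module.finrank ℂ (Submodule.span ℂ {w}) ≤ 1 := by
    simpa using finrank_span_le_card (R := ℂ) ({w} : Set ((E ⊗[ℂ] E) ⊗[ℂ] E))
  omega

lemma indep {p q : ℂ} (h : p • C 0 = q • C 1) : p = 0 ∧ q = 0 := by
  have e0 := congrArg (C.coord 0) h
  have e1 := congrArg (C.coord 1) h
  simp at e0 e1
  exact ⟨e0, e1.symm⟩

lemma two_points (h3 : Module.finrank ℂ E3 = 2)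
    (hsub : E3 ≤ leftTensorSub (L3 := E) E2 ⊓ rightTensorSub (L1 := E) E2)
    (hE2 : E2 ≤ Submodule.span ℂ {B 0 ⊗ₜ[ℂ] C 0, B 1 ⊗ₜ[ℂ] C 1}) :
    B.coord 0 (C 0) = 0 ∨ B.coord 1 (C 0) = 0 := by
  by_contra hcon
  push Not at hcon
  obtain ⟨hb0, hb1⟩ := hcon
  have key : ∀ x ∈ E3, ∃ v, x = (B 1 ⊗ₜ[ℂ] C 1) ⊗ₜ[ℂ] v ∧ ∃ p q : ℂ,
      p • C 0 = B.coord 0 (C 1) • v ∧ q • C 1 = B.coord 1 (C 1) • v := by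
    intro x hx
    obtain ⟨u, v, rfl, hc⟩ := forms hsub hE2 hx
    obtain ⟨p, q, h⟩ := hc (B.coord 0)
    obtain ⟨p', q', h'⟩ := hc (B.coord 1)
    have a0 := congrArg (c2 (B.coord 0)) h
    have a1 := congrArg (c2 (B.coord 1)) h
    have b0 := congrArg (c2 (B.coord 0)) h'
    have b1 := congrArg (c2 (B.coord 1)) h'
    simp only [map_add, map_smul, c2_tmul, c3_tmul, Module.Basis.coord_apply,
      Module.Basis.repr_self, Finsupp.single_apply] at a0 a1 b0 b1 hb0 hb1
    simp at a0 a1 b0 b1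
    have hpq := indep C (p := B.repr (C 0) 1 * p) (q := B.repr (C 0) 0 * q) (by
      rw [mul_smul, mul_smul, a0, a1, smul_comm])
    have hp : p = 0 := by simpa [hb1] using hpq.1
    have hu : u = 0 := by
      rw [hp, zero_smul] at a0
      simpa [hb0] using a0.symm
    subst hu
    exact ⟨v, by simp, p', q', by simpa using b0, by simpa using b1⟩
  by_cases hd : B.coord 0 (C 1) = 0
  · have hd1 : B.coord 1 (C 1) ≠ 0 := by
      intro hd1
      have := expand B (C 1)
      rw [hd, hd1] at this
      simp at this
      exact C.ne_zero 1 this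
    refine not_line E3 h3 ((B 1 ⊗ₜ[ℂ] C 1) ⊗ₜ[ℂ] C 1) fun x hx => ?_
    obtain ⟨v, rfl, p, q, -, h⟩ := key x hx
    refine ⟨(B.coord 1 (C 1))⁻¹ * q, ?_⟩
    rw [← TensorProduct.tmul_smul, mul_smul, h, smul_smul, inv_mul_cancel₀ hd1, one_smul]
  · refine not_line E3 h3 ((B 1 ⊗ₜ[ℂ] C 1) ⊗ₜ[ℂ] C 0) fun x hx => ?_
    obtain ⟨v, rfl, p, q, h, -⟩ := key x hx
    refine ⟨(B.coord 0 (C 1))⁻¹ * p, ?_⟩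
    rw [← TensorProduct.tmul_smul, mul_smul, h, smul_smul, inv_mul_cancel₀ hd, one_smul]

lemma gen1 (h2 : Module.finrank ℂ E2 = 2) (h3 : Module.finrank ℂ E3 = 2)
    (hsub : E3 ≤ leftTensorSub (L3 := E) E2 ⊓ rightTensorSub (L1 := E) E2)
    (hE2 : E2 ≤ Submodule.span ℂ {B 0 ⊗ₜ[ℂ] C 0, B 0 ⊗ₜ[ℂ] C 1}) : Concl E2 E3 := by
  refine shape1 B E2 E3 h2 h3 hsub (hE2.trans ?_)
  have aux : ∀ y : E, B 0 ⊗ₜ[ℂ] y ∈ Submodule.span ℂ {B 0 ⊗ₜ[ℂ] B 0, B 0 ⊗ₜ[ℂ] B 1} := by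
    intro y
    refine Submodule.mem_span_pair.2 ⟨B.coord 0 y, B.coord 1 y, ?_⟩
    conv_rhs => rw [expand B y]
    simp only [TensorProduct.tmul_add, TensorProduct.tmul_smul]
  rw [Submodule.span_le]
  rintro x (rfl | rfl) <;> exact aux _

lemma gen2 (h2 : Module.finrank ℂ E2 = 2) (h3 : Module.finrank ℂ E3 = 2)
    (hsub : E3 ≤ leftTensorSub (L3 := E) E2 ⊓ rightTensorSub (L1 := E) E2)
    (hE2 : E2 ≤ Submodule.span ℂ {B 0 ⊗ₜ[ℂ] C 0, B 1 ⊗ₜ[ℂ] C 0}) : Concl E2 E3 := by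
  refine shape2 C E2 E3 h2 h3 hsub (hE2.trans ?_)
  have aux : ∀ y : E, y ⊗ₜ[ℂ] C 0 ∈ Submodule.span ℂ {C 0 ⊗ₜ[ℂ] C 0, C 1 ⊗ₜ[ℂ] C 0} := by
    intro y
    refine Submodule.mem_span_pair.2 ⟨C.coord 0 y, C.coord 1 y, ?_⟩
    conv_rhs => rw [expand C y]
    simp only [TensorProduct.add_tmul, ← TensorProduct.smul_tmul']
  rw [Submodule.span_le]
  rintro x (rfl | rfl) <;> exact aux _

lemma gen3 (h2 : Module.finrank ℂ E2 = 2) (h3 : Module.finrank ℂ E3 = 2)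
    (hsub : E3 ≤ leftTensorSub (L3 := E) E2 ⊓ rightTensorSub (L1 := E) E2)
    (hE2 : E2 ≤ Submodule.span ℂ {B 0 ⊗ₜ[ℂ] C 0, B 1 ⊗ₜ[ℂ] C 1}) : Concl E2 E3 := by
  have hP := two_points B C E2 E3 h3 hsub hE2
  have hQ := two_points (B.reindex (Equiv.swap 0 1)) (C.reindex (Equiv.swap 0 1)) E2 E3 h3 hsub
    (by simpa [Set.pair_comm] using hE2)
  simp only [Module.Basis.coord_apply, Module.Basis.repr_reindex_apply,
    Module.Basis.reindex_apply, Equiv.symm_swap, Equiv.swap_apply_left,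
    Equiv.swap_apply_right] at hQ
  have x0 := expand B (C 0)
  have x1 := expand B (C 1)
  rw [Module.Basis.coord_apply, Module.Basis.coord_apply] at x0 x1 hP
  have bad : ∀ (y : E) (p q : ℂ), C 0 = p • y → C 1 = q • y → False := by
    intro y p q hp hq
    have := indep C (p := q) (q := p) (by rw [hp, hq, smul_comm])
    rw [this.1, zero_smul] at hq
    exact C.ne_zero 1 hq
  rcases hP with hP | hP <;> rcases hQ with hQ | hQ <;> rw [hP] at x0 <;> rw [hQ] at x1 <;>
    simp only [zero_smul, zero_add, add_zero] at x0 x1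
  · refine shape3' B E2 E3 h2 h3 hsub (hE2.trans ?_)
    rw [x0, x1, Submodule.span_le]
    rintro x (rfl | rfl)
    · exact Submodule.mem_span_pair.2 ⟨B.repr (C 0) 1, 0, by simp⟩
    · exact Submodule.mem_span_pair.2 ⟨0, B.repr (C 1) 0, by simp⟩
  · exact (bad _ _ _ x0 x1).elim
  · exact (bad _ _ _ x0 x1).elim
  · refine shape3 B E2 E3 h2 h3 hsub (hE2.trans ?_)
    rw [x0, x1, Submodule.span_le]
    rintro x (rfl | rfl)
    · exact Submodule.mem_span_pair.2 ⟨B.repr (C 0) 0, 0, by simp⟩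
    · exact Submodule.mem_span_pair.2 ⟨0, B.repr (C 1) 1, by simp⟩

lemma gen4 (h2 : Module.finrank ℂ E2 = 2) (h3 : Module.finrank ℂ E3 = 2)
    (hsub : E3 ≤ leftTensorSub (L3 := E) E2 ⊓ rightTensorSub (L1 := E) E2)
    (hE2 : E2 ≤ Submodule.span ℂ {B 0 ⊗ₜ[ℂ] C 0, B 0 ⊗ₜ[ℂ] C 1 + B 1 ⊗ₜ[ℂ] C 0}) :
    Concl E2 E3 := by
  have hb1 : B.repr (C 0) 1 = 0 := by
    by_contra hb1
    have zero : ∀ (v : E) (p q : ℂ), p • (B 0 ⊗ₜ[ℂ] C 0) + q • (B 0 ⊗ₜ[ℂ] C 1 + B 1 ⊗ₜ[ℂ] C 0)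
        = C 0 ⊗ₜ[ℂ] v → v = 0 := by
      intro v p q h
      have a0 := congrArg (c2 (B.coord 0)) h
      have a1 := congrArg (c2 (B.coord 1)) h
      simp at a0 a1
      have hq := indep C (p := B.repr (C 0) 0 * q - B.repr (C 0) 1 * p)
        (q := B.repr (C 0) 1 * q) (by
          rw [sub_smul, mul_smul, a1, smul_comm, ← a0]
          module)
      have hq0 : q = 0 := by simpa [hb1] using hq.2
      rw [hq0, zero_smul] at a1
      simpa [hb1] using a1.symm
    refine not_line E3 h3 0 fun x hx => ⟨0, ?_⟩
    obtain ⟨u, v, rfl, hc⟩ := forms hsub hE2 hx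
    obtain ⟨p, q, h⟩ := hc (B.coord 0)
    obtain ⟨p', q', h'⟩ := hc (B.coord 1)
    have hv : v = 0 := zero v p' q' (by rw [h']; simp [TensorProduct.add_tmul])
    subst hv
    have hu : u = 0 := zero u p q (by rw [h]; simp)
    subst hu
    simp
  have x0 := expand B (C 0)
  have x1 := expand B (C 1)
  rw [Module.Basis.coord_apply, Module.Basis.coord_apply] at x0 x1
  rw [hb1, zero_smul, add_zero] at x0
  have hb0 : B.repr (C 0) 0 ≠ 0 := by
    intro h
    rw [h, zero_smul] at x0
    exact C.ne_zero 0 x0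
  have hd1 : B.repr (C 1) 1 ≠ 0 := by
    intro h
    rw [h, zero_smul, add_zero] at x1
    have := indep C (p := B.repr (C 1) 0) (q := B.repr (C 0) 0) (by
      conv_lhs => rw [x0]
      conv_rhs => rw [x1]
      rw [smul_comm])
    exact hb0 this.2
  generalize B.repr (C 0) 0 = b at *
  generalize B.repr (C 1) 0 = d0 at *
  generalize B.repr (C 1) 1 = d1 at *
  refine shape4 B E2 E3 h2 h3 hsub (d1 / b) (div_ne_zero hd1 hb0) (hE2.trans ?_)
  rw [x0, x1, Submodule.span_le]
  rintro x (rfl | rfl)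
  · exact Submodule.mem_span_pair.2 ⟨b, 0, by simp⟩
  · refine Submodule.mem_span_pair.2 ⟨d0, b, ?_⟩
    simp only [TensorProduct.tmul_add, TensorProduct.tmul_smul]
    match_scalars <;> field_simp

end shapes

theorem stmt_11 {E1 : Type*} [AddCommGroup E1] [Module ℂ E1]
    (h1 : Module.finrank ℂ E1 = 2)
    (E2 : Submodule ℂ (E1 ⊗[ℂ] E1)) (E3 : Submodule ℂ ((E1 ⊗[ℂ] E1) ⊗[ℂ] E1))
    (h2 : Module.finrank ℂ E2 = 2) (h3 : Module.finrank ℂ E3 = 2)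
    (hsub : E3 ≤ leftTensorSub (L3 := E1) E2 ⊓ rightTensorSub (L1 := E1) E2) :
    -- there is a two-dimensional associative algebra `D` (the bilinear
    -- multiplication `m` on the two-dimensional space `V`), with surjective
    -- multiplication map `D ⊗ D → D`, and an automorphism `η` of `D`, ...
    ∃ m : V →ₗ[ℂ] V →ₗ[ℂ] V,
      (∀ x y z : V, m (m x y) z = m x (m y z)) ∧
      Function.Surjective (TensorProduct.lift m) ∧
      ∃ η : V ≃ₗ[ℂ] V,
        (∀ x y : V, η (m x y) = m (η x) (η y)) ∧
        -- ... such that the triple (E1,E2,E3) is isomorphic to (F1,F2,F3):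
        ∃ θ : E1 ≃ₗ[ℂ] Module.Dual ℂ V,
          Submodule.map (TensorProduct.map θ.toLinearMap θ.toLinearMap) E2 = F2 m η ∧
          Submodule.map (TensorProduct.map
            (TensorProduct.map θ.toLinearMap θ.toLinearMap) θ.toLinearMap) E3 = F3 m η := by
  obtain ⟨B, C, h | h | h | h⟩ := classify h1 E2 h2
  · exact gen1 B C E2 E3 h2 h3 hsub h.le
  · exact gen2 B C E2 E3 h2 h3 hsub h.le
  · exact gen3 B C E2 E3 h2 h3 hsub h.le
  · exact gen4 B C E2 E3 h2 h3 hsub h.le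

end Stmt11
end

section
/- For every graded algebra 𝒜 over ℂ satisfying condition (1.2) there exist a (not necessarily unital) associative ℂ-algebra D satisfying condition (1.4) and an algebra automorphism η of D such that the graded algebra ℬ = ℬ(D, η) given by the construction (1.3) is isomorphic to 𝒜 as a graded algebra. -/
open TensorProduct

section Graded

variable (A : ℕ → Type*) [∀ t, AddCommGroup (A t)] [∀ t, Module ℂ (A t)]
variable (mul : ∀ s t : ℕ, A s →ₗ[ℂ] A t →ₗ[ℂ] A (s + t))

/-- The multiplication map `M_{s,t} : 𝒜_s ⊗ 𝒜_t → 𝒜_{s+t}`. -/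
noncomputable def M2 (s t : ℕ) : (A s ⊗[ℂ] A t) →ₗ[ℂ] A (s + t) :=
  TensorProduct.lift (mul s t)

/-- The multiplication map `M_{r,s,t} : (𝒜_r ⊗ 𝒜_s) ⊗ 𝒜_t → 𝒜_{r+s+t}`. -/
noncomputable def M3 (r s t : ℕ) : ((A r ⊗[ℂ] A s) ⊗[ℂ] A t) →ₗ[ℂ] A (r + s + t) :=
  (M2 A mul (r + s) t).comp (TensorProduct.map (M2 A mul r s) LinearMap.id)

/-- Associativity of the graded multiplication. -/
def GradedAssoc : Prop :=
  ∀ (r s t : ℕ) (x : A r) (y : A s) (z : A t),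
    HEq (mul (r + s) t (mul r s x y) z) (mul r (s + t) x (mul s t y z))

/-- Condition (5.2): `Ker M_{r,s,t} = (Ker M_{r,s}) ⊗ 𝒜_t + 𝒜_r ⊗ (Ker M_{s,t})`
for all positive `r`, `s`, `t`. -/
def Cond52 : Prop :=
  ∀ r s t : ℕ, 1 ≤ r → 1 ≤ s → 1 ≤ t →
    LinearMap.ker (M3 A mul r s t) =
      LinearMap.range (TensorProduct.mapIncl (LinearMap.ker (M2 A mul r s))
          (⊤ : Submodule ℂ (A t))) ⊔
        Submodule.map (TensorProduct.assoc ℂ (A r) (A s) (A t)).symm.toLinearMap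
          (LinearMap.range (TensorProduct.mapIncl (⊤ : Submodule ℂ (A r))
            (LinearMap.ker (M2 A mul s t))))

/-- Condition (5.3): `M_{s,t}` is surjective for all positive `s`, `t`. -/
def Cond53 : Prop :=
  ∀ s t : ℕ, 1 ≤ s → 1 ≤ t → Function.Surjective (M2 A mul s t)


end Graded

abbrev VV := Fin 2 → ℂ

abbrev Bil := VV →ₗ[ℂ] VV →ₗ[ℂ] VV

theorem surj_ext {W : Type*} [AddCommGroup W] [Module ℂ W] (B : Bil)
    (hB : Function.Surjective (TensorProduct.lift B)) (f g : VV →ₗ[ℂ] W)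
    (h : ∀ x y, f (B x y) = g (B x y)) : f = g := by
  have h1 : f.comp (TensorProduct.lift B) = g.comp (TensorProduct.lift B) := by
    apply TensorProduct.ext'
    intro x y
    simpa using h x y
  ext1 i
  ext1
  obtain ⟨w, hw⟩ := hB (LinearMap.single ℂ (fun _ => ℂ) i 1)
  have := LinearMap.congr_fun h1 w
  simp only [LinearMap.comp_apply, hw] at this
  simpa using this

theorem lift_surj_of (B : Bil) (h : ∀ z, ∃ x y, B x y = z) :
    Function.Surjective (TensorProduct.lift B) := by
  intro z
  obtain ⟨x, y, hz⟩ := h z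
  exact ⟨x ⊗ₜ y, by simpa using hz⟩

def dd (v w : VV) : ℂ := v 0 * w 1 - v 1 * w 0

def qq (f : VV →ₗ[ℂ] VV) : ℂ := dd (f ![1, 0]) (f ![0, 1])

theorem vv_eq (x : VV) : x = x 0 • ![1, 0] + x 1 • ![0, 1] := by
  ext i; fin_cases i <;> simp

theorem qq_bij (f : VV →ₗ[ℂ] VV) (h : qq f ≠ 0) : Function.Bijective f := by
  have hi : Function.Injective f := by
    rw [injective_iff_map_eq_zero]
    intro x hx
    rw [vv_eq x, map_add, map_smul, map_smul] at hx
    have h0 := congrFun hx 0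
    have h1 := congrFun hx 1
    simp only [Pi.add_apply, Pi.smul_apply, smul_eq_mul, Pi.zero_apply] at h0 h1
    unfold qq dd at h
    generalize f ![1, 0] = a at *
    generalize f ![0, 1] = b at *
    have e0 : x 0 = 0 := by
      apply (mul_eq_zero.mp (_ : (a 0 * b 1 - a 1 * b 0) * x 0 = 0)).resolve_left h
      linear_combination b 1 * h0 - b 0 * h1
    have e1 : x 1 = 0 := by
      apply (mul_eq_zero.mp (_ : (a 0 * b 1 - a 1 * b 0) * x 1 = 0)).resolve_left h
      linear_combination a 0 * h1 - a 1 * h0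
    ext i; fin_cases i
    · exact e0
    · exact e1
  exact ⟨hi, LinearMap.injective_iff_surjective.mp hi⟩

theorem qq_add (f g : VV →ₗ[ℂ] VV) (t : ℂ) : qq (f + t • g) =
    qq f + (dd (f ![1, 0]) (g ![0, 1]) + dd (g ![1, 0]) (f ![0, 1])) * t + qq g * t ^ 2 := by
  simp only [qq, dd, LinearMap.add_apply, LinearMap.smul_apply, Pi.add_apply, Pi.smul_apply,
    smul_eq_mul]
  ring

/-- Two bilinear maps with generic nondegeneracy have a common nondegenerate element. -/
theorem common_elt (B C : Bil) (h1 : ∃ e, qq (B e) ≠ 0) (h2 : ∃ e, qq (C e) ≠ 0) :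
    ∃ e, qq (B e) ≠ 0 ∧ qq (C e) ≠ 0 := by
  obtain ⟨a, ha⟩ := h1
  obtain ⟨b, hb⟩ := h2
  let P : Bil → Polynomial ℂ := fun F => Polynomial.C (qq (F a)) +
    Polynomial.C (dd (F a ![1, 0]) (F b ![0, 1]) + dd (F b ![1, 0]) (F a ![0, 1])) * Polynomial.X +
    Polynomial.C (qq (F b)) * Polynomial.X ^ 2
  have hP : ∀ F t, (P F).eval t = qq (F (a + t • b)) := by
    intro F t
    rw [map_add, map_smul, qq_add]
    simp [P]
  have hB : P B ≠ 0 := by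
    intro h
    apply ha
    have := hP B 0
    rw [h] at this
    simpa using this.symm
  have hC : P C ≠ 0 := by
    intro h
    apply hb
    have : (P C).coeff 2 = 0 := by rw [h]; simp
    simpa [P, Polynomial.coeff_X, Polynomial.coeff_C] using this
  have hBC := mul_ne_zero hB hC
  by_contra! hcon
  apply hBC
  apply Polynomial.funext
  intro t
  rw [Polynomial.eval_mul, hP, hP]
  by_cases h : qq (B (a + t • b)) = 0
  · rw [h, zero_mul, Polynomial.eval_zero]
  · rw [hcon _ h, mul_zero, Polynomial.eval_zero]

theorem bil_expand (B : Bil) (x y : VV) : B x y =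
    x 0 • (y 0 • B ![1, 0] ![1, 0] + y 1 • B ![1, 0] ![0, 1]) +
    x 1 • (y 0 • B ![0, 1] ![1, 0] + y 1 • B ![0, 1] ![0, 1]) := by
  conv_lhs => rw [vv_eq x, vv_eq y]
  simp only [map_add, map_smul, LinearMap.add_apply, LinearMap.smul_apply]
  module

theorem par_of (a b c : VV) (h : dd a b ≠ 0) (hc : dd a c = 0) : ∃ l : ℂ, c = l • a := by
  unfold dd at *
  by_cases h0 : a 0 = 0
  · have h1 : a 1 ≠ 0 := by rintro h1; simp [h0, h1] at h
    refine ⟨c 1 / a 1, ?_⟩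
    ext i; fin_cases i
    · simp [h0] at hc ⊢; tauto
    · simp; field_simp
  · refine ⟨c 0 / a 0, ?_⟩
    ext i; fin_cases i
    · simp; field_simp
    · simp; field_simp; linear_combination hc

theorem dd_swap (a b : VV) : dd a b = - dd b a := by unfold dd; ring

theorem dd_smul (a b : VV) (l k : ℂ) : dd (l • a) (k • b) = l * k * dd a b := by
  simp [dd]; ring

theorem aux_par (a b c d : VV) (h : dd a b ≠ 0) (h1 : dd a c = 0) (h2 : dd b d = 0)
    (h3 : dd a d + dd b c = 0) : ∃ l : ℂ, c = l • a ∧ d = l • b := by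
  obtain ⟨l, rfl⟩ := par_of a b c h h1
  obtain ⟨k, rfl⟩ := par_of b a d (by rw [dd_swap]; simpa using h) h2
  have e1 : dd a (k • b) = k * dd a b := by simp [dd]; ring
  have e2 : dd b (l • a) = - (l * dd a b) := by simp [dd]; ring
  rw [e1, e2] at h3
  have : (k - l) * dd a b = 0 := by linear_combination h3
  have hk : k = l := sub_eq_zero.mp ((mul_eq_zero.mp this).resolve_right h)
  exact ⟨l, rfl, by rw [hk]⟩

theorem eq_zero_of_dd (b : VV) (h : ∀ z, dd b z = 0) : b = 0 := by
  have h0 := h ![1, 0]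
  have h1 := h ![0, 1]
  simp [dd] at h0 h1
  ext i; fin_cases i
  · exact h1
  · exact h0

def ddl (b : VV) : VV →ₗ[ℂ] ℂ where
  toFun := dd b
  map_add' x y := by simp [dd]; ring
  map_smul' c x := by simp [dd]; ring

theorem typeL_lin (B : Bil) (hB : Function.Surjective (TensorProduct.lift B))
    (h : ∀ y, qq (B.flip y) = 0) :
    ∃ (e : VV) (u : VV →ₗ[ℂ] ℂ), qq (B e) ≠ 0 ∧ u ≠ 0 ∧ ∀ x y, B x y = u x • B e y := by
  have h1 := h ![1, 0]
  have h2 := h ![0, 1]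
  have h3 := h (![1, 0] + (1 : ℂ) • ![0, 1])
  rw [map_add, map_smul, qq_add, h1, h2] at h3
  have hex := bil_expand B
  simp only [qq, LinearMap.flip_apply] at h1 h2 h3 ⊢
  set a := B ![1, 0] ![1, 0] with ha
  set b := B ![1, 0] ![0, 1] with hb
  set c := B ![0, 1] ![1, 0] with hc
  set d := B ![0, 1] ![0, 1] with hd
  have h3' : dd a d + dd b c = 0 := by linear_combination h3
  by_cases hab : dd a b = 0
  · by_cases hcd : dd c d = 0
    · exfalso
      have hac : dd a d = 0 := by
        by_contra hne
        obtain ⟨l, hl⟩ := par_of a d b hne hab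
        obtain ⟨k, hk⟩ := par_of a d c hne h1
        rw [hl, hk, dd_smul] at h3'
        apply hne
        have : dd a a = 0 := by unfold dd; ring
        rw [this] at h3'
        linear_combination h3'
      have hbc : dd b c = 0 := by linear_combination h3' - hac
      have sw : ∀ v w, dd v w = 0 → dd w v = 0 := by
        intro v w hvw; rw [dd_swap, hvw, neg_zero]
      have sf : ∀ v, dd v v = 0 := by intro v; unfold dd; ring
      have key : ∀ v, dd v a = 0 → dd v b = 0 → dd v c = 0 → dd v d = 0 → v = 0 := by
        intro v va vb vc vd
        apply eq_zero_of_dd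
        have : ddl v = 0 := by
          apply surj_ext B hB
          intro x y
          have va' : ddl v a = 0 := va
          have vb' : ddl v b = 0 := vb
          have vc' : ddl v c = 0 := vc
          have vd' : ddl v d = 0 := vd
          rw [hex]
          simp [va', vb', vc', vd']
        intro z
        exact LinearMap.congr_fun this z
      have a0 := key a (sf _) hab h1 hac
      have b0 := key b (sw _ _ hab) (sf _) hbc h2
      have c0 := key c (sw _ _ h1) (sw _ _ hbc) (sf _) hcd
      have d0 := key d (sw _ _ hac) (sw _ _ h2) (sw _ _ hcd) (sf _)
      have : (LinearMap.id : VV →ₗ[ℂ] VV) = 0 := by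
        apply surj_ext B hB
        intro x y
        rw [hex, a0, b0, c0, d0]
        simp
      have h5 := congrFun (LinearMap.congr_fun this ![1, 0]) 0
      simp at h5
    · obtain ⟨l, hl1, hl2⟩ := aux_par c d a b hcd (by rw [dd_swap, h1, neg_zero])
        (by rw [dd_swap, h2, neg_zero])
        (by rw [dd_swap c, dd_swap d]; linear_combination -h3')
      refine ⟨![0, 1], l • LinearMap.proj 0 + LinearMap.proj 1, hcd, ?_, ?_⟩
      · intro h0
        have := LinearMap.congr_fun h0 ![0, 1]
        simp at this
      · intro x y
        rw [hex, hex, hl1, hl2]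
        simp
        module
  · obtain ⟨l, hl1, hl2⟩ := aux_par a b c d hab h1 h2 h3'
    refine ⟨![1, 0], LinearMap.proj 0 + l • LinearMap.proj 1, hab, ?_, ?_⟩
    · intro h0
      have := LinearMap.congr_fun h0 ![1, 0]
      simp at this
    · intro x y
      rw [hex, hex, hl1, hl2]
      simp
      module

def MAssoc (μ : ℕ → ℕ → Bil) : Prop := ∀ r s t, 1 ≤ r → 1 ≤ s → 1 ≤ t → ∀ x y z,
  μ (r + s) t (μ r s x y) z = μ r (s + t) x (μ s t y z)

def MSurj (μ : ℕ → ℕ → Bil) : Prop := ∀ s t, 1 ≤ s → 1 ≤ t →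
  Function.Surjective (TensorProduct.lift (μ s t))

def opp (μ : ℕ → ℕ → Bil) : ℕ → ℕ → Bil := fun s t => (μ t s).flip

theorem opp_assoc (μ : ℕ → ℕ → Bil) (h : MAssoc μ) : MAssoc (opp μ) := by
  intro r s t hr hs ht x y z
  have := h t s r ht hs hr z y x
  simp only [opp, LinearMap.flip_apply]
  rw [add_comm r s, add_comm s t, this]

theorem flip_surj (B : Bil) (h : Function.Surjective (TensorProduct.lift B)) :
    Function.Surjective (TensorProduct.lift B.flip) := by
  have : TensorProduct.lift B.flip =
      (TensorProduct.lift B).comp (TensorProduct.comm ℂ VV VV).toLinearMap := by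
    apply TensorProduct.ext'
    intro x y
    simp
  rw [this, LinearMap.coe_comp]
  exact h.comp (TensorProduct.comm ℂ VV VV).surjective

theorem opp_surj (μ : ℕ → ℕ → Bil) (h : MSurj μ) : MSurj (opp μ) :=
  fun s t hs ht => flip_surj _ (h t s ht hs)

/-- Left multiplication by `e` is bijective in all degrees once it is in degree 1. -/
theorem left_bij (μ : ℕ → ℕ → Bil) (ha : MAssoc μ) (hs : MSurj μ) (e : VV)
    (he : Function.Bijective (μ 1 1 e)) (t : ℕ) (ht : 1 ≤ t) : Function.Bijective (μ 1 t e) := by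
  rcases Nat.lt_or_ge 1 t with h | h
  · obtain ⟨k, rfl⟩ := Nat.exists_eq_add_of_le h.le
    have hk : 1 ≤ k := by omega
    have hsur : LinearMap.range (μ 1 (1 + k) e) = ⊤ := by
      rw [← Submodule.ker_mkQ (LinearMap.range (μ 1 (1 + k) e)), LinearMap.ker_eq_top]
      apply surj_ext _ (hs (1 + 1) k (by omega) hk)
      intro x y
      obtain ⟨x', rfl⟩ := he.2 x
      rw [ha 1 1 k le_rfl le_rfl hk]
      simp
    have := LinearMap.range_eq_top.mp hsur
    exact ⟨LinearMap.injective_iff_surjective.mpr this, this⟩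
  · have : t = 1 := by omega
    subst this
    exact he

theorem exists_rho (F : ℕ → VV →ₗ[ℂ] VV) (hF : ∀ t, 1 ≤ t → Function.Bijective (F t)) :
    ∃ ρ : ℕ → VV ≃ₗ[ℂ] VV, (∀ x, ρ 1 x = x) ∧ ∀ t, 1 ≤ t → ∀ x, ρ (t + 1) x = F t (ρ t x) := by
  classical
  let R : ℕ → VV ≃ₗ[ℂ] VV := fun t => if h : 1 ≤ t then LinearEquiv.ofBijective (F t) (hF t h)
    else LinearEquiv.refl ℂ VV
  let ρ : ℕ → VV ≃ₗ[ℂ] VV := fun t => Nat.rec (LinearEquiv.refl ℂ VV) (fun n r => r.trans (R n)) t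
  refine ⟨ρ, fun x => ?_, fun t ht x => ?_⟩
  · simp [ρ, R]
  · change R t (ρ t x) = _
    simp [R, ht]

theorem typeL (μ : ℕ → ℕ → Bil) (ha : MAssoc μ) (hs : MSurj μ)
    (h : ∀ y, qq ((μ 1 1).flip y) = 0) :
    ∃ (u : VV →ₗ[ℂ] ℂ) (ρ : ℕ → VV ≃ₗ[ℂ] VV), u ≠ 0 ∧ ∀ s t, 1 ≤ s → 1 ≤ t → ∀ x y,
      μ s t (ρ s x) (ρ t y) = u x • ρ (s + t) y := by
  obtain ⟨e, u, he, hu, hB⟩ := typeL_lin (μ 1 1) (hs 1 1 le_rfl le_rfl) h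
  have hL := left_bij μ ha hs e (qq_bij _ he)
  obtain ⟨ρ, h1, h2⟩ := exists_rho (fun t => μ 1 t e) hL
  have key : ∀ t, 1 ≤ t → ∀ x y, μ 1 t x y = u x • μ 1 t e y := by
    intro t ht
    rcases Nat.lt_or_ge 1 t with h | h
    · obtain ⟨k, rfl⟩ := Nat.exists_eq_add_of_le h.le
      have hk : 1 ≤ k := by omega
      intro x
      have : μ 1 (1 + k) x = u x • μ 1 (1 + k) e := by
        apply surj_ext _ (hs 1 k le_rfl hk)
        intro y z
        rw [LinearMap.smul_apply, ← ha 1 1 k le_rfl le_rfl hk, ← ha 1 1 k le_rfl le_rfl hk, hB]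
        simp
      intro y
      rw [this]; rfl
    · have : t = 1 := by omega
      subst this
      exact hB
  refine ⟨u, ρ, hu, ?_⟩
  intro s t hs1 ht x y
  induction s, hs1 using Nat.le_induction with
  | base => rw [h1, key t ht, add_comm 1 t, h2 t ht]
  | succ s hs1 ih =>
    have e1 : s + 1 + t = (s + t) + 1 := by ring
    rw [h2 s hs1, e1, h2 (s + t) (by omega), add_comm s 1, ha 1 s t le_rfl hs1 ht, ih, map_smul]

theorem unital (μ : ℕ → ℕ → Bil) (ha : MAssoc μ) (hs : MSurj μ) (e : VV)
    (hL : Function.Bijective (μ 1 1 e)) (hR : Function.Bijective ((μ 1 1).flip e)) :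
    ∃ m : Bil, (∀ x y z, m (m x y) z = m x (m y z)) ∧
      Function.Surjective (TensorProduct.lift m) ∧
      ∃ η : VV ≃ₗ[ℂ] VV, (∀ x y, η (m x y) = m (η x) (η y)) ∧
        ∃ ρ : ℕ → VV ≃ₗ[ℂ] VV, ∀ s t, 1 ≤ s → 1 ≤ t → ∀ x y,
          μ s t (ρ s x) (ρ t y) = ρ (s + t) (m x ((η.toLinearMap ^ s) y)) := by
  have hRR := left_bij (opp μ) (opp_assoc μ ha) (opp_surj μ hs) e hR
  obtain ⟨ρ, h1, h2⟩ := exists_rho (fun t => opp μ 1 t e) hRR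
  simp only [opp, LinearMap.flip_apply] at h2
  let Re := LinearEquiv.ofBijective _ hR
  let Le := LinearEquiv.ofBijective _ hL
  let η : VV ≃ₗ[ℂ] VV := Le.trans Re.symm
  have hη : ∀ x, μ 1 1 (η x) e = μ 1 1 e x := by
    intro x
    have : Re (η x) = Le x := by simp [η]
    exact this
  let m : Bil := ((μ 1 1).compl₂ η.symm.toLinearMap).compr₂ Re.symm.toLinearMap
  have hm : ∀ x y, μ 1 1 (m x (η y)) e = μ 1 1 x y := by
    intro x y
    have : Re (m x (η y)) = μ 1 1 x y := by simp [m]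
    exact this
  have heρ : ∀ t, 1 ≤ t → ∀ b, μ 1 t e (ρ t b) = ρ (t + 1) (η b) := by
    intro t ht b
    induction t, ht using Nat.le_induction with
    | base => rw [h2 1 le_rfl, h1, h1, hη]
    | succ t ht ih =>
      rw [h2 t ht, h2 (t + 1) (by omega), ← ha 1 t 1 le_rfl ht le_rfl, ih, add_comm 1 t]
  have h1t : ∀ t, 1 ≤ t → ∀ a b, μ 1 t a (ρ t b) = ρ (t + 1) (m a (η b)) := by
    intro t ht a b
    induction t, ht using Nat.le_induction with
    | base => rw [h2 1 le_rfl, h1, h1, hm]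
    | succ t ht ih =>
      rw [h2 t ht, h2 (t + 1) (by omega), ← ha 1 t 1 le_rfl ht le_rfl, ih, add_comm 1 t]
  have main : ∀ s t, 1 ≤ s → 1 ≤ t → ∀ x y,
      μ s t (ρ s x) (ρ t y) = ρ (s + t) (m x ((η.toLinearMap ^ s) y)) := by
    intro s t hs1
    induction s, hs1 using Nat.le_induction generalizing t with
    | base =>
      intro ht x y
      rw [h1, h1t t ht, add_comm 1 t]
      simp
    | succ s hs1 ih =>
      intro ht x y
      have e1 : s + 1 + t = s + (t + 1) := by ring
      rw [h2 s hs1, ha s 1 t hs1 le_rfl ht, heρ t ht, add_comm 1 t, ih (t + 1) (by omega), e1,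
        pow_succ]
      rfl
  have hη1 : ∀ b c, η (m b (η c)) = m (η b) (η (η c)) := by
    intro b c
    apply (ρ 3).injective
    have k1 := ha 1 1 1 le_rfl le_rfl le_rfl e b c
    have k2 : μ 1 1 b c = ρ 2 (m b (η c)) := by simpa [h1] using h1t 1 le_rfl b c
    have k3 : μ 1 1 e b = ρ 2 (η b) := by simpa [h1] using heρ 1 le_rfl b
    have k4 := main 2 1 (by omega) le_rfl (η b) c
    rw [h1] at k4
    have k5 := heρ 2 (by omega) (m b (η c))
    rw [k2, k3] at k1
    rw [show (1 + 1 : ℕ) = 2 from rfl] at k1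
    rw [k4, k5] at k1
    rw [← k1, pow_two]
    rfl
  have hη2 : ∀ x y, η (m x y) = m (η x) (η y) := by
    intro x y
    obtain ⟨y, rfl⟩ := η.surjective y
    exact hη1 x y
  have hassoc : ∀ x y z, m (m x y) z = m x (m y z) := by
    intro a y z
    obtain ⟨b, rfl⟩ := η.surjective y
    obtain ⟨z, rfl⟩ := η.surjective z
    obtain ⟨c, rfl⟩ := η.surjective z
    apply (ρ 3).injective
    have k1 := ha 1 1 1 le_rfl le_rfl le_rfl a b c
    have k2 : ∀ b c, μ 1 1 b c = ρ 2 (m b (η c)) := fun b c => by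
      simpa [h1] using h1t 1 le_rfl b c
    have k4 := main 2 1 (by omega) le_rfl (m a (η b)) c
    rw [h1] at k4
    have k5 := h1t 2 (by omega) a (m b (η c))
    rw [k2, k2] at k1
    rw [show (1 + 1 : ℕ) = 2 from rfl] at k1
    rw [k4, k5, hη2, pow_two] at k1
    exact k1
  refine ⟨m, hassoc, ?_, η, hη2, ρ, main⟩
  apply lift_surj_of
  intro z
  refine ⟨z, η e, ?_⟩
  apply Re.injective
  exact hm z e

theorem core (μ : ℕ → ℕ → Bil) (ha : MAssoc μ) (hs : MSurj μ) :
    ∃ m : Bil, (∀ x y z, m (m x y) z = m x (m y z)) ∧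
      Function.Surjective (TensorProduct.lift m) ∧
      ∃ η : VV ≃ₗ[ℂ] VV, (∀ x y, η (m x y) = m (η x) (η y)) ∧
        ∃ ρ : ℕ → VV ≃ₗ[ℂ] VV, ∀ s t, 1 ≤ s → 1 ≤ t → ∀ x y,
          μ s t (ρ s x) (ρ t y) = ρ (s + t) (m x ((η.toLinearMap ^ s) y)) := by
  have hid : ∀ s : ℕ, ((LinearEquiv.refl ℂ VV).toLinearMap ^ s) = LinearMap.id := by
    intro s
    exact one_pow s
  by_cases hR : ∀ y, qq ((μ 1 1).flip y) = 0
  · obtain ⟨u, ρ, hu, h⟩ := typeL μ ha hs hR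
    let m : Bil := (LinearMap.lsmul ℂ VV).comp u
    have hm : ∀ x y, m x y = u x • y := fun x y => rfl
    refine ⟨m, ?_, ?_, LinearEquiv.refl ℂ VV, fun x y => rfl, ρ, ?_⟩
    · intro x y z
      simp [hm, smul_smul]
    · apply lift_surj_of
      intro z
      obtain ⟨x, hx⟩ : ∃ x, u x ≠ 0 := by
        by_contra! hc
        exact hu (LinearMap.ext hc)
      exact ⟨x, (u x)⁻¹ • z, by rw [hm, smul_smul, mul_inv_cancel₀ hx, one_smul]⟩
    · intro s t hs1 ht x y
      rw [h s t hs1 ht, hid, hm, map_smul]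
      rfl
  by_cases hL : ∀ y, qq (μ 1 1 y) = 0
  · obtain ⟨u, ρ, hu, h⟩ := typeL (opp μ) (opp_assoc μ ha) (opp_surj μ hs) hL
    let m : Bil := ((LinearMap.lsmul ℂ VV).comp u).flip
    have hm : ∀ x y, m x y = u y • x := fun x y => rfl
    refine ⟨m, ?_, ?_, LinearEquiv.refl ℂ VV, fun x y => rfl, ρ, ?_⟩
    · intro x y z
      simp [hm, smul_smul, mul_comm]
    · apply lift_surj_of
      intro z
      obtain ⟨x, hx⟩ : ∃ x, u x ≠ 0 := by
        by_contra! hc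
        exact hu (LinearMap.ext hc)
      exact ⟨(u x)⁻¹ • z, x, by rw [hm, smul_smul, mul_inv_cancel₀ hx, one_smul]⟩
    · intro s t hs1 ht x y
      have := h t s ht hs1 y x
      simp only [opp, LinearMap.flip_apply] at this
      rw [this, hid, hm, map_smul, add_comm]
      rfl
  push Not at hR hL
  obtain ⟨e, h1, h2⟩ := common_elt _ _ hL hR
  exact unital μ ha hs e (qq_bij _ h1) (qq_bij _ h2)

/-- **Main theorem** (Theorem 1.2 of the paper). Every graded algebra `𝒜` with all
positive components two-dimensional and all multiplication maps
`M_{s,t} : 𝒜_s ⊗ 𝒜_t → 𝒜_{s+t}` surjective is isomorphic to the graded algebra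
`ℬ = ℬ(D, η)` built from a two-dimensional algebra `D` (a bilinear associative
multiplication `m` on `ℂ²` whose induced map `D ⊗ D → D` is surjective) and an
automorphism `η` of `D`, where `ℬ_t = D` and `x ×_ℬ y = x ·_D η^s(y)` for
`x ∈ ℬ_s`, `y ∈ ℬ_t`. -/
theorem stmt_19 (A : ℕ → Type*) [∀ t, AddCommGroup (A t)] [∀ t, Module ℂ (A t)]
    (mul : ∀ s t : ℕ, A s →ₗ[ℂ] A t →ₗ[ℂ] A (s + t)) (hassoc : GradedAssoc A mul)
    (hdim : ∀ t : ℕ, 1 ≤ t → Module.finrank ℂ (A t) = 2)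
    (hsurj : Cond53 A mul) :
    ∃ m : (Fin 2 → ℂ) →ₗ[ℂ] (Fin 2 → ℂ) →ₗ[ℂ] (Fin 2 → ℂ),
      -- `D` is associative
      (∀ x y z : Fin 2 → ℂ, m (m x y) z = m x (m y z)) ∧
      -- the multiplication map `D ⊗ D → D` is surjective
      Function.Surjective (TensorProduct.lift m) ∧
      ∃ η : (Fin 2 → ℂ) ≃ₗ[ℂ] (Fin 2 → ℂ),
        -- `η` is an automorphism of `D`
        (∀ x y : Fin 2 → ℂ, η (m x y) = m (η x) (η y)) ∧
        -- the graded algebras `𝒜` and `ℬ(D, η)` are isomorphic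
        ∃ θ : ∀ t, A t →ₗ[ℂ] (Fin 2 → ℂ),
          (∀ t : ℕ, 1 ≤ t → Function.Bijective (θ t)) ∧
          ∀ s t : ℕ, 1 ≤ s → 1 ≤ t → ∀ (x : A s) (y : A t),
            θ (s + t) (mul s t x y) = m (θ s x) ((η.toLinearMap ^ s) (θ t y)) := by
  classical
  have heq : ∀ t, 1 ≤ t → Nonempty (A t ≃ₗ[ℂ] VV) := by
    intro t ht
    have h2 := hdim t ht
    haveI : FiniteDimensional ℂ (A t) := FiniteDimensional.of_finrank_pos (by omega)
    exact FiniteDimensional.nonempty_linearEquiv_of_finrank_eq (by simp [h2])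
  choose E hE using fun t => (show ∃ p : (A t →ₗ[ℂ] VV) × (VV →ₗ[ℂ] A t),
      1 ≤ t → (∀ x, p.2 (p.1 x) = x) ∧ (∀ x, p.1 (p.2 x) = x) from by
    by_cases ht : 1 ≤ t
    · obtain ⟨f⟩ := heq t ht
      exact ⟨(f.toLinearMap, f.symm.toLinearMap), fun _ => ⟨by simp, by simp⟩⟩
    · exact ⟨(0, 0), fun h => absurd h ht⟩)
  let μ : ℕ → ℕ → Bil := fun s t =>
    ((mul s t).compl₁₂ (E s).2 (E t).2).compr₂ (E (s + t)).1
  have hμ : ∀ s t x y, μ s t x y = (E (s + t)).1 (mul s t ((E s).2 x) ((E t).2 y)) :=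
    fun s t x y => rfl
  have hcast : ∀ (a b : ℕ) (x : A a) (y : A b), a = b → HEq x y → (E a).1 x = (E b).1 y := by
    intro a b x y hab hxy
    subst hab
    rw [eq_of_heq hxy]
  have ha : MAssoc μ := by
    intro r s t hr hs ht x y z
    simp only [hμ]
    rw [(hE (r + s) (by omega)).1, (hE (s + t) (by omega)).1]
    exact hcast _ _ _ _ (add_assoc r s t) (hassoc r s t _ _ _)
  have hs : MSurj μ := by
    intro s t hs ht z
    obtain ⟨w, hw⟩ := hsurj s t hs ht ((E (s + t)).2 z)
    refine ⟨TensorProduct.map (E s).1 (E t).1 w, ?_⟩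
    have : (TensorProduct.lift (μ s t)).comp (TensorProduct.map (E s).1 (E t).1) =
        (E (s + t)).1.comp (M2 A mul s t) := by
      apply TensorProduct.ext'
      intro x y
      simp [M2, hμ, (hE s hs).1, (hE t ht).1]
    have h2 := LinearMap.congr_fun this w
    simp only [LinearMap.comp_apply, hw] at h2
    rw [h2, (hE (s + t) (by omega)).2]
  obtain ⟨m, hm1, hm2, η, hη, ρ, hρ⟩ := core μ ha hs
  refine ⟨m, hm1, hm2, η, hη, fun t => (ρ t).symm.toLinearMap.comp (E t).1, ?_, ?_⟩
  · intro t ht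
    rw [LinearMap.coe_comp]
    refine (ρ t).symm.bijective.comp ?_
    exact Function.bijective_iff_has_inverse.mpr ⟨(E t).2, (hE t ht).1, (hE t ht).2⟩
  · intro s t hs ht x y
    simp only [LinearMap.comp_apply, LinearEquiv.coe_coe]
    rw [LinearEquiv.symm_apply_eq, ← hρ s t hs ht, LinearEquiv.apply_symm_apply,
      LinearEquiv.apply_symm_apply, hμ, (hE s hs).1, (hE t ht).1]
end
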